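/- arXiv:2304.05083 — 7 statements merged into one kernel-verified Lean document; each statement's English description precedes it below -/
import Mathlib

section
/- Let 0 < μ₁ < μ₂, I₀ > 0 and I_eq > 0. Define μ(I) = μ₁ + (μ₂ − μ₁)/(1 + I₀/I), F(I) = μ₂ + ((μ₂ − μ₁)/2)·(1/(1 + I/I₀) − 3·log(1 + I/I₀)/(I/I₀)), and f(I) = F(I) − (I_eq/I)·F(I_eq) for I > 0. Then f(I_eq) = 0 and, for all I > 0, μ(I) − (I/2)·μ'(I) = f(I) + I·f'(I) (the first stability condition with Z = μ). -/
/-- For the μ(I)-rheology, the dilatancy function `f I = F I - (I_eq/I) F I_eq` satisfies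
the equilibrium condition `f I_eq = 0` and the first stability condition
`μ - (I/2) μ' = f + I f'` for all `I > 0`. -/
theorem muI_first_stability (μ₁ μ₂ I₀ Ieq : ℝ) (h₁ : 0 < μ₁) (h₁₂ : μ₁ < μ₂)
    (hI₀ : 0 < I₀) (hIeq : 0 < Ieq) (μ F f : ℝ → ℝ)
    (hμ : ∀ I, μ I = μ₁ + (μ₂ - μ₁) / (1 + I₀ / I))
    (hF : ∀ I, F I = μ₂ + (μ₂ - μ₁) / 2 *
        (1 / (1 + I / I₀) - 3 * Real.log (1 + I / I₀) / (I / I₀)))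
    (hf : ∀ I, f I = F I - Ieq / I * F Ieq) :
    f Ieq = 0 ∧
      ∃ μ' f' : ℝ → ℝ, ∀ I > 0,
        HasDerivAt μ (μ' I) I ∧ HasDerivAt f (f' I) I ∧
        μ I - I / 2 * μ' I = f I + I * f' I := by
  obtain rfl : μ = fun I => μ₁ + (μ₂ - μ₁) / (1 + I₀ / I) := funext hμ
  obtain rfl : f = fun I => F I - Ieq / I * F Ieq := funext hf
  refine ⟨by simp [div_self hIeq.ne'], fun I => (μ₂ - μ₁) * I₀ / (I + I₀) ^ 2,
    fun I => (μ₂ - μ₁) / 2 * (-(1 / I₀) / (1 + I / I₀) ^ 2 -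
      (3 * (1 / I₀ / (1 + I / I₀)) * (I / I₀) - 3 * Real.log (1 + I / I₀) * (1 / I₀)) /
        (I / I₀) ^ 2) + Ieq / I ^ 2 * F Ieq, fun I hI => ?_⟩
  have hx : 1 + I / I₀ ≠ 0 := by positivity
  have hy : 1 + I₀ / I ≠ 0 := by positivity
  have h_inv (c : ℝ) : HasDerivAt (fun J => c / J) (-c / I ^ 2) I := by
    simpa using (hasDerivAt_const I c).fun_div (hasDerivAt_id' I) hI.ne'
  have h_ratio : HasDerivAt (fun J => J / I₀) (1 / I₀) I := (hasDerivAt_id' I).div_const I₀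
  have h_one : HasDerivAt (fun J => 1 + J / I₀) (1 / I₀) I := h_ratio.const_add 1
  refine ⟨?_, ?_, ?_⟩
  · refine (((hasDerivAt_const I (μ₂ - μ₁)).fun_div
      ((h_inv I₀).const_add 1) hy).const_add μ₁).congr_deriv ?_
    field_simp
    ring
  · have hF' := ((((hasDerivAt_const I (1 : ℝ)).fun_div h_one hx).fun_sub
      (((h_one.log hx).const_mul 3).fun_div h_ratio (by positivity))).const_mul
        ((μ₂ - μ₁) / 2)).const_add μ₂
    rw [← funext hF] at hF'
    refine (hF'.fun_sub ((h_inv Ieq).mul_const (F Ieq))).congr_deriv ?_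
    ring
  · simp only [hF I]
    field_simp
    ring
end

section
/- Define H(x) = 1/(1 + x) − 3·log(1 + x)/x for x > 0. Then H'(x) > 0 for all x > 0, H(x) → −2 as x → 0⁺, and H(x) → 0 as x → +∞; consequently −2 < H(x) < 0 for all x > 0. -/
open Filter Topology

lemma hasDerivAt_one_div_sub_log_div {x : ℝ} (hx : 0 < x) :
    HasDerivAt (fun x : ℝ => 1 / (1 + x) - 3 * Real.log (1 + x) / x)
      (3 * Real.log (1 + x) / x ^ 2 - (4 * x + 3) / (x * (1 + x) ^ 2)) x := by
  have h1 : (1 + x) ≠ 0 := by positivity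
  have ha : HasDerivAt (fun x : ℝ => 1 + x) 1 x := (hasDerivAt_id x).const_add 1
  refine (((hasDerivAt_const x (1 : ℝ)).fun_div ha h1).fun_sub
    (((ha.log h1).const_mul 3).fun_div (hasDerivAt_id' x) hx.ne')).congr_deriv ?_
  field_simp
  ring

lemma rational_lt_three_mul_log_div_sq {x : ℝ} (hx : 0 < x) :
    (4 * x + 3) / (x * (1 + x) ^ 2) < 3 * Real.log (1 + x) / x ^ 2 := by
  have h := Real.lt_log_one_add_of_pos hx
  calc (4 * x + 3) / (x * (1 + x) ^ 2) < 3 * (2 * x / (x + 2)) / x ^ 2 := by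
        rw [← sub_pos]
        have : 3 * (2 * x / (x + 2)) / x ^ 2 - (4 * x + 3) / (x * (1 + x) ^ 2)
            = (2 * x + 1) / ((x + 2) * (1 + x) ^ 2) := by
          field_simp
          ring
        rw [this]
        positivity
    _ < _ := by gcongr

lemma one_div_sub_log_div_neg {x : ℝ} (hx : 0 < x) :
    1 / (1 + x) - 3 * Real.log (1 + x) / x < 0 := by
  have h := Real.lt_log_one_add_of_pos hx
  rw [sub_neg]
  calc 1 / (1 + x) < 3 * (2 * x / (x + 2)) / x := by
        rw [← sub_pos]
        have : 3 * (2 * x / (x + 2)) / x - 1 / (1 + x)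
            = (5 * x + 4) / ((x + 2) * (1 + x)) := by
          field_simp
          ring
        rw [this]
        positivity
    _ < _ := by gcongr

lemma tendsto_one_div_sub_log_div_nhdsGT_zero :
    Tendsto (fun x : ℝ => 1 / (1 + x) - 3 * Real.log (1 + x) / x) (𝓝[>] 0) (𝓝 (-2)) := by
  have hlog : Tendsto (fun x : ℝ => Real.log (1 + x) / x) (𝓝[>] 0) (𝓝 1) := by
    simpa [div_eq_inv_mul] using (Real.hasDerivAt_log one_ne_zero).tendsto_slope_zero_right
  have hinv : Tendsto (fun x : ℝ => 1 / (1 + x)) (𝓝[>] 0) (𝓝 (1 / (1 + 0))) :=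
    ContinuousAt.tendsto (f := fun x : ℝ => 1 / (1 + x)) (x := 0)
      (by fun_prop (disch := norm_num)) |>.mono_left nhdsWithin_le_nhds
  convert hinv.sub (hlog.const_mul 3) using 2
  · ring
  · norm_num

lemma tendsto_one_div_sub_log_div_atTop :
    Tendsto (fun x : ℝ => 1 / (1 + x) - 3 * Real.log (1 + x) / x) atTop (𝓝 0) := by
  have hadd : Tendsto (fun x : ℝ => 1 + x) atTop atTop :=
    tendsto_atTop_add_const_left _ 1 tendsto_id
  have hlog : Tendsto (fun x : ℝ => Real.log (1 + x) / x) atTop (𝓝 0) := by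
    simpa [Function.comp_def] using
      (Real.tendsto_pow_log_div_mul_add_atTop 1 (-1) 1 one_ne_zero).comp hadd
  simpa [mul_div_assoc] using hadd.inv_tendsto_atTop.sub (hlog.const_mul 3)

/-- The function `H x = 1/(1+x) - 3 log(1+x)/x` is strictly increasing on `(0,∞)`
(its derivative is positive there), tends to `-2` as `x → 0⁺`, tends to `0` as
`x → +∞`, and consequently satisfies `-2 < H x < 0` for all `x > 0`. -/
theorem H_monotone_and_bounds (H : ℝ → ℝ)
    (hH : ∀ x, H x = 1 / (1 + x) - 3 * Real.log (1 + x) / x) :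
    (∃ H' : ℝ → ℝ, ∀ x > 0, HasDerivAt H (H' x) x ∧ 0 < H' x) ∧
    Tendsto H (𝓝[>] 0) (𝓝 (-2)) ∧
    Tendsto H atTop (𝓝 0) ∧
    ∀ x > 0, -2 < H x ∧ H x < 0 := by
  obtain rfl : H = fun x => 1 / (1 + x) - 3 * Real.log (1 + x) / x := funext hH
  refine ⟨⟨_, fun x hx => ⟨hasDerivAt_one_div_sub_log_div hx,
    sub_pos.2 (rational_lt_three_mul_log_div_sq hx)⟩⟩,
    tendsto_one_div_sub_log_div_nhdsGT_zero, tendsto_one_div_sub_log_div_atTop,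
    fun x hx => ⟨?_, one_div_sub_log_div_neg hx⟩⟩
  have hmono : StrictMonoOn (fun x : ℝ => 1 / (1 + x) - 3 * Real.log (1 + x) / x) (Set.Ioi 0) := by
    refine strictMonoOn_of_deriv_pos (convex_Ioi 0)
      (fun y hy => (hasDerivAt_one_div_sub_log_div hy).continuousAt.continuousWithinAt)
      fun y hy => ?_
    rw [interior_Ioi] at hy
    rw [(hasDerivAt_one_div_sub_log_div hy).deriv]
    exact sub_pos.2 (rational_lt_three_mul_log_div_sq hy)
  have hx2 : 0 < x / 2 := half_pos hx
  refine lt_of_le_of_lt (le_of_tendsto tendsto_one_div_sub_log_div_nhdsGT_zero ?_)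
    (hmono hx2 hx (half_lt_self hx))
  filter_upwards [Ioo_mem_nhdsGT hx2] with y hy
  exact (hmono hy.1 hx2 hy.2).le
end

section
/- Let 0 < μ₁ < μ₂, I₀ > 0 and I_eq > 0. Define F(I) = μ₂ + ((μ₂ − μ₁)/2)·(1/(1 + I/I₀) − 3·log(1 + I/I₀)/(I/I₀)) for I > 0. Then for all I > 0, F'(I) + (I_eq/I²)·F(I_eq) > 0. -/
/-- A lower bound for the logarithm expressing that the dilatancy function is increasing. -/
lemma log_one_add_lower {x : ℝ} (hx : 0 < x) :
    0 < 3 * Real.log (1 + x) - 3 * x / (1 + x) - x ^ 2 / (1 + x) ^ 2 := by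
  have h := Real.le_log_one_add_of_nonneg hx.le
  have key : 3 * (2 * x / (x + 2)) - 3 * x / (1 + x) - x ^ 2 / (1 + x) ^ 2
      = x ^ 2 * (1 + 2 * x) / ((x + 2) * (1 + x) ^ 2) := by
    field_simp
    ring
  have hpos : 0 < x ^ 2 * (1 + 2 * x) / ((x + 2) * (1 + x) ^ 2) := by positivity
  linarith

/-- The upper bound `log (1 + y) < (2 y + y / (1 + y)) / 3`. -/
lemma log_one_add_upper {y : ℝ} (hy : 0 < y) :
    3 * Real.log (1 + y) < 2 * y + y / (1 + y) := by
  have h : Real.log (1 + y) ≤ Real.sinh (Real.log (1 + y)) :=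
    Real.self_le_sinh_iff.2 (Real.log_nonneg (by linarith))
  rw [Real.sinh_log (by linarith)] at h
  have key : 2 * y + y / (1 + y) - 3 * ((1 + y - (1 + y)⁻¹) / 2) = y ^ 2 / (2 * (1 + y)) := by
    field_simp
    ring
  have hpos : 0 < y ^ 2 / (2 * (1 + y)) := by positivity
  linarith

/-- Third stability condition for the μ(I)-rheology: for
`F I = μ₂ + ((μ₂-μ₁)/2)(1/(1+I/I₀) - 3 log(1+I/I₀)/(I/I₀))`,
one has `F'(I) + (I_eq/I²) F(I_eq) > 0` for all `I > 0`. -/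
theorem muI_third_stability (μ₁ μ₂ I₀ Ieq : ℝ) (h₁ : 0 < μ₁) (h₁₂ : μ₁ < μ₂)
    (hI₀ : 0 < I₀) (hIeq : 0 < Ieq) (F : ℝ → ℝ)
    (hF : ∀ I, F I = μ₂ + (μ₂ - μ₁) / 2 *
        (1 / (1 + I / I₀) - 3 * Real.log (1 + I / I₀) / (I / I₀))) :
    ∃ F' : ℝ → ℝ, ∀ I > 0,
      HasDerivAt F (F' I) I ∧ 0 < F' I + Ieq / I ^ 2 * F Ieq := by
  have hd : 0 < (μ₂ - μ₁) / 2 := by linarith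
  have hFeq : 0 < F Ieq := by
    rw [hF]
    have hy : 0 < Ieq / I₀ := by positivity
    generalize Ieq / I₀ = y at hy
    have hb : -2 < 1 / (1 + y) - 3 * Real.log (1 + y) / y := by
      have key : 1 / (1 + y) - 3 * Real.log (1 + y) / y + 2
          = (2 * y + y / (1 + y) - 3 * Real.log (1 + y)) / y := by
        field_simp
        ring
      have hpos := div_pos (sub_pos.2 (log_one_add_upper hy)) hy
      linarith
    have := mul_lt_mul_of_pos_left hb hd
    linarith
  refine ⟨fun I => (μ₂ - μ₁) / 2 * ((3 * Real.log (1 + I / I₀) - 3 * (I / I₀) / (1 + I / I₀)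
    - (I / I₀) ^ 2 / (1 + I / I₀) ^ 2) / (I / I₀) ^ 2 / I₀), fun I hI => ⟨?_, ?_⟩⟩
  · have hx : 0 < I / I₀ := by positivity
    have hg : HasDerivAt (fun I : ℝ => I / I₀) (1 / I₀) I := (hasDerivAt_id I).div_const I₀
    have hg1 : HasDerivAt (fun I : ℝ => 1 + I / I₀) (1 / I₀) I := hg.const_add 1
    have h1x : 1 + I / I₀ ≠ 0 := by positivity
    have h := ((((hasDerivAt_const I (1 : ℝ)).div hg1 h1x).sub
      (((hg1.log h1x).const_mul 3).div hg hx.ne')).const_mul ((μ₂ - μ₁) / 2)).const_add μ₂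
    rw [funext hF]
    refine h.congr_deriv ?_
    beta_reduce
    generalize I / I₀ = x at hx h1x
    generalize Real.log (1 + x) = L
    field_simp
    ring
  · have hA := log_one_add_lower (x := I / I₀) (by positivity)
    have : 0 < Ieq / I ^ 2 * F Ieq := by positivity
    refine add_pos (mul_pos hd (div_pos (div_pos hA ?_) hI₀)) this
    positivity
end

section
/- Let 0 < μ₁ < μ₂ and I₀ > 0. Define μ(I) = μ₁ + (μ₂ − μ₁)/(1 + I₀/I) and F(I) = μ₂ + ((μ₂ − μ₁)/2)·(1/(1 + I/I₀) − 3·log(1 + I/I₀)/(I/I₀)) for I > 0. Then for all I > 0, μ(I) − F(I) = (3(μ₂ − μ₁)/2)·( log(1 + I/I₀)/(I/I₀) − 1/(1 + I/I₀) ), and this quantity is strictly positive. -/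
theorem inv_one_add_lt_log_one_add_div {x : ℝ} (hx : 0 < x) :
    1 / (1 + x) < Real.log (1 + x) / x := by
  have hx1 : 0 < 1 + x := by linarith
  have hlog := Real.log_lt_sub_one_of_pos (inv_pos.mpr hx1) (inv_lt_one_of_one_lt₀ (by linarith)).ne
  rw [Real.log_inv] at hlog
  have h : 1 / (1 + x) * x = 1 - (1 + x)⁻¹ := by
    field_simp
    ring
  rw [lt_div_iff₀ hx, h]
  linarith

/-- Dissipation condition for the μ(I)-rheology: for all `I > 0`,
`μ(I) - F(I) = (3(μ₂-μ₁)/2)(log(1+I/I₀)/(I/I₀) - 1/(1+I/I₀))`, and this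
quantity is strictly positive. -/
theorem muI_dissipation (μ₁ μ₂ I₀ : ℝ) (h₁ : 0 < μ₁) (h₁₂ : μ₁ < μ₂) (hI₀ : 0 < I₀)
    (μ F : ℝ → ℝ)
    (hμ : ∀ I, μ I = μ₁ + (μ₂ - μ₁) / (1 + I₀ / I))
    (hF : ∀ I, F I = μ₂ + (μ₂ - μ₁) / 2 *
        (1 / (1 + I / I₀) - 3 * Real.log (1 + I / I₀) / (I / I₀))) :
    ∀ I > 0,
      μ I - F I = 3 * (μ₂ - μ₁) / 2 *
          (Real.log (1 + I / I₀) / (I / I₀) - 1 / (1 + I / I₀)) ∧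
      0 < μ I - F I := by
  intro I hI
  have hx : 0 < I / I₀ := div_pos hI hI₀
  have key : μ I - F I = 3 * (μ₂ - μ₁) / 2 *
      (Real.log (1 + I / I₀) / (I / I₀) - 1 / (1 + I / I₀)) := by
    have hfrac : (μ₂ - μ₁) / (1 + I₀ / I) = (μ₂ - μ₁) - (μ₂ - μ₁) * (1 / (1 + I / I₀)) := by
      have : I + I₀ ≠ 0 := by positivity
      have : I₀ + I ≠ 0 := by positivity
      field_simp
      ring
    rw [hμ, hF, hfrac]
    ring
  refine ⟨key, ?_⟩
  rw [key]
  exact mul_pos (by linarith) (sub_pos.mpr (inv_one_add_lt_log_one_add_div hx))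
end

section
/- Let 0 < μ₁ < μ₂, I₀ > 0 and I_eq > 0. With μ(I) = μ₁ + (μ₂ − μ₁)/(1 + I₀/I), F(I) = μ₂ + ((μ₂ − μ₁)/2)·(1/(1 + I/I₀) − 3·log(1 + I/I₀)/(I/I₀)) and f(I) = F(I) − (I_eq/I)·F(I_eq): (i) for all I > 0, μ(I) − (I/2)μ'(I) = μ₁ + (μ₂ − μ₁)·(I/I₀)·(1 + 2I/I₀)/(2(1 + I/I₀)²) > 0, so I ↦ I·f(I) is strictly increasing on (0,∞); (ii) consequently f(I) > 0 for I > I_eq, f(I) < 0 for 0 < I < I_eq, and f(I_eq) = 0 (the equilibrium conditions). -/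
theorem hasDerivAt_muI (a d : ℝ) {c x : ℝ} (hc : 0 < c) (hx : 0 < x) :
    HasDerivAt (fun y => a + d / (1 + c / y)) (d * c / (c + x) ^ 2) x := by
  have hx' : x ≠ 0 := hx.ne'
  have hne : 1 + c / x ≠ 0 := by positivity
  have h := ((hasDerivAt_const x d).div
    (((hasDerivAt_const x c).div (hasDerivAt_id x) hx').const_add 1) hne).const_add a
  refine h.congr_deriv ?_
  simp only [Pi.div_apply, id]
  field_simp
  ring

/-- The primitive of `μ - (I/2)μ'`, up to an additive constant. -/
theorem hasDerivAt_muI_primitive (a d : ℝ) {c x : ℝ} (hc : 0 < c) (hx : 0 < x) :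
    HasDerivAt (fun y => (a + d) * y + d / 2 * (y / (1 + y / c) - 3 * c * Real.log (1 + y / c)))
      (a + d * (x / c) * (1 + 2 * x / c) / (2 * (1 + x / c) ^ 2)) x := by
  have hne : 1 + x / c ≠ 0 := by positivity
  have hl : HasDerivAt (fun y => 1 + y / c) (1 / c) x :=
    ((hasDerivAt_id x).div_const c).const_add 1
  have h := ((hasDerivAt_id x).const_mul (a + d)).add
    ((((hasDerivAt_id x).div hl hne).sub ((hl.log hne).const_mul (3 * c))).const_mul (d / 2))
  refine h.congr_deriv ?_
  simp only [id]
  field_simp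
  ring

/-- Equilibrium conditions for the μ(I)-rheology: (i) `μ - (I/2)μ'` equals the explicit
positive expression `μ₁ + (μ₂-μ₁)(I/I₀)(1+2I/I₀)/(2(1+I/I₀)²)`, so `I ↦ I f(I)` is
strictly increasing on `(0,∞)`; (ii) consequently `f > 0` for `I > I_eq`, `f < 0` for
`0 < I < I_eq`, and `f(I_eq) = 0`. -/
theorem muI_equilibrium_conditions (μ₁ μ₂ I₀ Ieq : ℝ) (h₁ : 0 < μ₁) (h₁₂ : μ₁ < μ₂)
    (hI₀ : 0 < I₀) (hIeq : 0 < Ieq) (μ F f : ℝ → ℝ)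
    (hμ : ∀ I, μ I = μ₁ + (μ₂ - μ₁) / (1 + I₀ / I))
    (hF : ∀ I, F I = μ₂ + (μ₂ - μ₁) / 2 *
        (1 / (1 + I / I₀) - 3 * Real.log (1 + I / I₀) / (I / I₀)))
    (hf : ∀ I, f I = F I - Ieq / I * F Ieq) :
    (∃ μ' : ℝ → ℝ, ∀ I > 0,
        HasDerivAt μ (μ' I) I ∧
        μ I - I / 2 * μ' I
          = μ₁ + (μ₂ - μ₁) * (I / I₀) * (1 + 2 * I / I₀) / (2 * (1 + I / I₀) ^ 2) ∧
        0 < μ I - I / 2 * μ' I) ∧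
    StrictMonoOn (fun I => I * f I) (Set.Ioi 0) ∧
    (∀ I, Ieq < I → 0 < f I) ∧
    (∀ I, 0 < I → I < Ieq → f I < 0) ∧
    f Ieq = 0 := by
  have hd : 0 < μ₂ - μ₁ := sub_pos.2 h₁₂
  have hpos : ∀ I > 0,
      0 < μ₁ + (μ₂ - μ₁) * (I / I₀) * (1 + 2 * I / I₀) / (2 * (1 + I / I₀) ^ 2) := by
    intro I hI
    positivity
  have hmono : StrictMonoOn (fun I => I * f I) (Set.Ioi 0) := by
    have hG : ∀ I > 0, HasDerivAt (fun I => I * f I)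
        (μ₁ + (μ₂ - μ₁) * (I / I₀) * (1 + 2 * I / I₀) / (2 * (1 + I / I₀) ^ 2)) I := by
      intro I hI
      refine ((hasDerivAt_muI_primitive μ₁ (μ₂ - μ₁) hI₀ hI).sub_const
        (Ieq * F Ieq)).congr_of_eventuallyEq ?_
      filter_upwards [lt_mem_nhds hI] with y hy
      have hy' : y ≠ 0 := hy.ne'
      have hne : I₀ + y ≠ 0 := by positivity
      rw [hf, hF y]
      generalize F Ieq = k
      generalize Real.log (1 + y / I₀) = l
      field_simp
      ring
    refine strictMonoOn_of_deriv_pos (convex_Ioi 0)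
      (fun I hI => (hG I hI).continuousAt.continuousWithinAt) fun I hI => ?_
    rw [interior_Ioi] at hI
    rw [(hG I hI).deriv]
    exact hpos I hI
  have hzero : f Ieq = 0 := by
    rw [hf, div_self hIeq.ne', one_mul, sub_self]
  refine ⟨⟨fun I => (μ₂ - μ₁) * I₀ / (I₀ + I) ^ 2, fun I hI => ?_⟩, hmono, ?_, ?_, hzero⟩
  · have heq : μ I - I / 2 * ((μ₂ - μ₁) * I₀ / (I₀ + I) ^ 2)
        = μ₁ + (μ₂ - μ₁) * (I / I₀) * (1 + 2 * I / I₀) / (2 * (1 + I / I₀) ^ 2) := by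
      have hI' : I ≠ 0 := hI.ne'
      have hne : I₀ + I ≠ 0 := by positivity
      rw [hμ]
      field_simp
      ring
    refine ⟨?_, heq, heq ▸ hpos I hI⟩
    rw [funext hμ]
    exact hasDerivAt_muI μ₁ (μ₂ - μ₁) hI₀ hI
  · intro I hI
    have hI0 : 0 < I := hIeq.trans hI
    have h : Ieq * f Ieq < I * f I := hmono hIeq hI0 hI
    rw [hzero, mul_zero] at h
    exact (mul_pos_iff_of_pos_left hI0).1 h
  · intro I hI0 hI
    have h : I * f I < Ieq * f Ieq := hmono hI0 hIeq hI
    rw [hzero, mul_zero] at h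
    exact neg_of_mul_neg_right h hI0.le
end

section
/- Let I₁ > 0, I_eq > 0, and let Z : (0,∞) → ℝ be differentiable. Define W(I) = (3/(2I))·∫_{I₁}^{I} Z(J) dJ − Z(I)/2 and f(I) = W(I) − (I_eq/I)·W(I_eq) for I > 0. Then f(I_eq) = 0 and, for all I > 0, Z(I) − (I/2)·Z'(I) = f(I) + I·f'(I). -/
/-- Generic rheology: for a differentiable yield function `Z` (with derivative `Z'`), the
dilatancy function `f I = W I - (I_eq/I) W I_eq`, with
`W I = (3/(2I)) ∫_{I₁}^I Z(J) dJ - Z(I)/2`, satisfies the equilibrium condition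
`f I_eq = 0` and the first stability condition `Z - (I/2)Z' = f + I f'` on `(0,∞)`. -/
theorem generic_first_stability (I₁ Ieq : ℝ) (hI₁ : 0 < I₁) (hIeq : 0 < Ieq)
    (Z Z' W f : ℝ → ℝ)
    (hZ : ∀ I > 0, HasDerivAt Z (Z' I) I)
    (hW : ∀ I, W I = 3 / (2 * I) * (∫ J in I₁..I, Z J) - Z I / 2)
    (hf : ∀ I, f I = W I - Ieq / I * W Ieq) :
    f Ieq = 0 ∧
      ∃ f' : ℝ → ℝ, ∀ I > 0,
        HasDerivAt f (f' I) I ∧ Z I - I / 2 * Z' I = f I + I * f' I := by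
  refine ⟨by rw [hf, div_self hIeq.ne', one_mul, sub_self],
    fun I => (Z I - I / 2 * Z' I - f I) / I, fun I hI => ⟨?_, by field_simp; ring⟩⟩
  have hcont : ContinuousOn Z (Set.Ioi 0) := fun x hx => (hZ x hx).continuousAt.continuousWithinAt
  have hsub : Set.uIcc I₁ I ⊆ Set.Ioi 0 := fun x hx => lt_of_lt_of_le (lt_min hI₁ hI) hx.1
  have hF : HasDerivAt (fun x => ∫ J in I₁..x, Z J) (Z I) I :=
    intervalIntegral.integral_hasDerivAt_right (hcont.mono hsub).intervalIntegrable
      (hcont.stronglyMeasurableAtFilter isOpen_Ioi I hI) (hZ I hI).continuousAt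
  have hf_eq : f = fun x =>
      3 / 2 * x⁻¹ * (∫ J in I₁..x, Z J) - Z x / 2 - Ieq * W Ieq * x⁻¹ := by
    funext x
    rw [hf, hW x]
    ring
  have hinv := hasDerivAt_inv hI.ne'
  rw [hf_eq]
  refine ((((hinv.const_mul (3 / 2)).mul hF).sub ((hZ I hI).div_const 2)).sub
    (hinv.const_mul (Ieq * W Ieq))).congr_deriv ?_
  field_simp
  ring
end

section
/- Let δ ∈ (0, π/2), I_eq > 0, and set β = 2(1 − cos δ)/(2 + cos δ). Define ψ(I) = (sin δ/(1 − cos δ))·(1 − (I_eq/I)^β) for I > 0. Then ψ(I_eq) = 0 and, for all I > 0, (2 + cos δ)·I·ψ'(I) + 2(1 − cos δ)·ψ(I) = 2·sin δ. -/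
open Real

/-- For the Drucker–Prager rheology with dilatancy effects, the dilatancy angle
`ψ I = (sin δ/(1 - cos δ))(1 - (I_eq/I)^β)` with `β = 2(1 - cos δ)/(2 + cos δ)`
vanishes at `I = I_eq` and solves the ODE
`(2 + cos δ) I ψ' + 2(1 - cos δ) ψ = 2 sin δ` on `(0,∞)`. -/
theorem dilatancy_angle_ode (δ Ieq : ℝ) (hδ : δ ∈ Set.Ioo 0 (π / 2)) (hIeq : 0 < Ieq)
    (β : ℝ) (hβ : β = 2 * (1 - Real.cos δ) / (2 + Real.cos δ))
    (ψ : ℝ → ℝ)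
    (hψ : ∀ I, ψ I = Real.sin δ / (1 - Real.cos δ) * (1 - (Ieq / I) ^ β)) :
    ψ Ieq = 0 ∧
      ∃ ψ' : ℝ → ℝ, ∀ I > 0,
        HasDerivAt ψ (ψ' I) I ∧
        (2 + Real.cos δ) * I * ψ' I + 2 * (1 - Real.cos δ) * ψ I = 2 * Real.sin δ := by
  have hc1 : Real.cos δ < 1 := by
    simpa using Real.cos_lt_cos_of_nonneg_of_le_pi_div_two le_rfl hδ.2.le hδ.1
  have hc0 : 0 < Real.cos δ := Real.cos_pos_of_mem_Ioo ⟨by linarith [hδ.1, Real.pi_pos], hδ.2⟩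
  have h1 : 1 - Real.cos δ ≠ 0 := by linarith
  have h2 : 2 + Real.cos δ ≠ 0 := by linarith
  refine ⟨by rw [hψ, div_self hIeq.ne', Real.one_rpow, sub_self, mul_zero],
    fun I => Real.sin δ / (1 - Real.cos δ) * (β * (Ieq / I) ^ β / I), fun I hI => ⟨?_, ?_⟩⟩
  · have hI0 : I ≠ 0 := hI.ne'
    have hq : Ieq / I ≠ 0 := (div_pos hIeq hI).ne'
    have hdiv : HasDerivAt (fun x : ℝ => Ieq / x) (-(Ieq / I) / I) I := by
      simp only [div_eq_mul_inv]
      refine ((hasDerivAt_inv hI0).const_mul Ieq).congr_deriv ?_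
      field_simp
    rw [funext hψ]
    refine (((hdiv.rpow_const (p := β) (Or.inl hq)).const_sub 1).const_mul
      (Real.sin δ / (1 - Real.cos δ))).congr_deriv ?_
    rw [Real.rpow_sub_one hq]
    field_simp
  · have hI0 : I ≠ 0 := hI.ne'
    have hβ' : (2 + Real.cos δ) * β = 2 * (1 - Real.cos δ) := by
      rw [hβ]
      field_simp
    beta_reduce
    rw [hψ]
    generalize (Ieq / I) ^ β = q
    field_simp
    linear_combination q * Real.sin δ * hβ'
end
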